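/- arXiv:2105.00724 — 3 statements merged into one kernel-verified Lean document; each statement's English description precedes it below -/
import Mathlib

section
/- Let Y_1 and Z be independent standard normal random variables, let ρ ∈ (−1,1), and set Y_2 := ρ Y_1 + √(1−ρ²) Z (so that (Y_1,Y_2) is a centered bivariate Gaussian vector with unit variances and correlation ρ). Then E[(Y_1² − 1)·1{Y_1 ≥ 0, Y_2 ≥ 0}] = ρ√(1−ρ²)/(2π). -/
open MeasureTheory ProbabilityTheory

open Filter Topology Real

lemma continuous_gaussianPDFReal (μ : ℝ) (v : NNReal) : Continuous (gaussianPDFReal μ v) := by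
  rw [gaussianPDFReal_def]
  fun_prop

lemma hasDerivAt_gaussianReal_Iic (x : ℝ) :
    HasDerivAt (fun x ↦ (gaussianReal 0 1).real (Set.Iic x)) (gaussianPDFReal 0 1 x) x := by
  have hint := integrable_gaussianPDFReal 0 1
  have h : (fun x ↦ (gaussianReal 0 1).real (Set.Iic x)) = fun x ↦
      (∫ t in Set.Iic 0, gaussianPDFReal 0 1 t) + ∫ t in (0 : ℝ)..x, gaussianPDFReal 0 1 t := by
    ext x
    rw [← intervalIntegral.integral_Iic_sub_Iic hint.integrableOn hint.integrableOn,
      add_sub_cancel, measureReal_def, gaussianReal_apply_eq_integral 0 one_ne_zero,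
      ENNReal.toReal_ofReal]
    exact integral_nonneg fun t ↦ gaussianPDFReal_nonneg 0 1 t
  rw [h]
  exact (intervalIntegral.integral_hasDerivAt_right hint.intervalIntegrable
    (stronglyMeasurable_gaussianPDFReal 0 1).stronglyMeasurableAtFilter
    (continuous_gaussianPDFReal 0 1).continuousAt).const_add _

lemma gaussianReal_real_Ici_neg (x : ℝ) :
    (gaussianReal 0 1).real (Set.Ici (-x)) = (gaussianReal 0 1).real (Set.Iic x) := by
  have h : gaussianReal 0 1 = (gaussianReal 0 1).map (fun x ↦ -x) := by
    rw [gaussianReal_map_neg, neg_zero]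
  conv_lhs => rw [h, map_measureReal_apply measurable_neg measurableSet_Ici]
  congr 1
  ext y
  simp

lemma gaussianPDFReal_zero_one (x : ℝ) :
    gaussianPDFReal 0 1 x = (√(2 * π))⁻¹ * exp (-x ^ 2 / 2) := by
  simp [gaussianPDFReal]

lemma gaussianPDFReal_mul_gaussianPDFReal_mul (a y : ℝ) :
    gaussianPDFReal 0 1 y * gaussianPDFReal 0 1 (a * y) =
      (2 * π)⁻¹ * exp (-((1 + a ^ 2) / 2) * y ^ 2) := by
  rw [gaussianPDFReal_zero_one, gaussianPDFReal_zero_one, mul_mul_mul_comm, ← exp_add,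
    ← mul_inv, mul_self_sqrt (by positivity)]
  ring_nf

lemma hasDerivAt_gaussianPDFReal_zero_one (y : ℝ) :
    HasDerivAt (gaussianPDFReal 0 1) (-y * gaussianPDFReal 0 1 y) y := by
  have h : gaussianPDFReal 0 1 = fun y ↦ (√(2 * π))⁻¹ * exp (-y ^ 2 / 2) :=
    funext gaussianPDFReal_zero_one
  rw [h]
  convert! ((((hasDerivAt_id y).pow 2).neg.div_const 2).exp.const_mul (√(2 * π))⁻¹) using 1
  simp
  ring

lemma tendsto_mul_gaussianPDFReal_atTop :
    Tendsto (fun y ↦ y * gaussianPDFReal 0 1 y) atTop (𝓝 0) := by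
  have h := (tendsto_rpow_abs_mul_exp_neg_mul_sq_cocompact (a := 1 / 2) (by norm_num) 1).mono_left
    atTop_le_cocompact
  have h' := h.const_mul (√(2 * π))⁻¹
  rw [mul_zero] at h'
  refine h'.congr' ?_
  filter_upwards [eventually_ge_atTop 0] with y hy
  rw [gaussianPDFReal_zero_one, rpow_one, abs_of_nonneg hy]
  ring_nf

lemma integrable_sq_sub_one_gaussianReal :
    Integrable (fun y : ℝ ↦ y ^ 2 - 1) (gaussianReal 0 1) :=
  (memLp_id_gaussianReal' 2 (by simp)).integrable_sq.sub (integrable_const 1)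

lemma integrable_sq_sub_one_mul_gaussianPDFReal :
    Integrable (fun y : ℝ ↦ (y ^ 2 - 1) * gaussianPDFReal 0 1 y) := by
  have h := integrable_sq_sub_one_gaussianReal
  rw [gaussianReal_of_var_ne_zero 0 one_ne_zero,
    integrable_withDensity_iff (measurable_gaussianPDF 0 1)
      (ae_of_all _ fun _ ↦ gaussianPDF_lt_top)] at h
  simpa using h

/-- The left-hand side is `∫ y in Ioi 0, (y ^ 2 - 1) * φ y * Φ (a * y)`, where `φ` and `Φ` are the
standard normal density and distribution function. -/
lemma integral_Ioi_hermite_two_mul_gaussian (a : ℝ) :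
    ∫ y in Set.Ioi (0 : ℝ), (y ^ 2 - 1) * gaussianPDFReal 0 1 y *
        (gaussianReal 0 1).real (Set.Iic (a * y)) = a / (2 * π * (1 + a ^ 2)) := by
  have ha : 0 < 1 + a ^ 2 := by positivity
  have hderiv (y : ℝ) : HasDerivAt (fun y ↦
      -(y * gaussianPDFReal 0 1 y) * (gaussianReal 0 1).real (Set.Iic (a * y)) -
        a / (2 * π * (1 + a ^ 2)) * exp (-((1 + a ^ 2) / 2) * y ^ 2))
      ((y ^ 2 - 1) * gaussianPDFReal 0 1 y * (gaussianReal 0 1).real (Set.Iic (a * y))) y := by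
    have hΦ := (hasDerivAt_gaussianReal_Iic (a * y)).comp y ((hasDerivAt_id y).const_mul a)
    have hφ := ((hasDerivAt_id y).mul (hasDerivAt_gaussianPDFReal_zero_one y)).neg
    have he := ((((hasDerivAt_id y).pow 2).const_mul (-((1 + a ^ 2) / 2))).exp).const_mul
      (a / (2 * π * (1 + a ^ 2)))
    refine ((hφ.mul hΦ).sub he).congr_deriv ?_
    have hprod := gaussianPDFReal_mul_gaussianPDFReal_mul a y
    simp only [id, Function.comp_apply, Pi.neg_apply, Pi.mul_apply, Pi.pow_apply]
    have : exp (-((1 + a ^ 2) / 2) * y ^ 2) =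
        2 * π * (gaussianPDFReal 0 1 y * gaussianPDFReal 0 1 (a * y)) := by
      rw [hprod]
      field_simp
    rw [this]
    field_simp
    push_cast
    ring
  have hlim : Tendsto (fun y ↦
      -(y * gaussianPDFReal 0 1 y) * (gaussianReal 0 1).real (Set.Iic (a * y)) -
        a / (2 * π * (1 + a ^ 2)) * exp (-((1 + a ^ 2) / 2) * y ^ 2)) atTop (𝓝 0) := by
    have h₁ : Tendsto (fun y ↦ -(y * gaussianPDFReal 0 1 y) *
        (gaussianReal 0 1).real (Set.Iic (a * y))) atTop (𝓝 0) := by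
      refine Tendsto.zero_mul_isBoundedUnder_le
        (by simpa using tendsto_mul_gaussianPDFReal_atTop.neg) ?_
      refine isBoundedUnder_of ⟨1, fun y ↦ ?_⟩
      simp [abs_of_nonneg measureReal_nonneg]
    have h₂ : Tendsto (fun y : ℝ ↦ exp (-((1 + a ^ 2) / 2) * y ^ 2)) atTop (𝓝 0) :=
      tendsto_exp_atBot.comp
        ((tendsto_pow_atTop two_ne_zero).const_mul_atTop_of_neg (by linarith))
    simpa using h₁.sub (h₂.const_mul (a / (2 * π * (1 + a ^ 2))))
  have hmeas : Measurable fun y : ℝ ↦ (gaussianReal 0 1).real (Set.Iic (a * y)) :=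
    (continuous_iff_continuousAt.2 fun x ↦
      (hasDerivAt_gaussianReal_Iic x).continuousAt).measurable.comp (measurable_const_mul a)
  have hint : Integrable fun y : ℝ ↦ (y ^ 2 - 1) * gaussianPDFReal 0 1 y *
      (gaussianReal 0 1).real (Set.Iic (a * y)) :=
    integrable_sq_sub_one_mul_gaussianPDFReal.mul_bdd (c := 1) hmeas.aestronglyMeasurable
      (ae_of_all _ fun y ↦ by simp [abs_of_nonneg measureReal_nonneg])
  rw [integral_Ioi_of_hasDerivAt_of_tendsto' (fun y _ ↦ hderiv y) hint.integrableOn hlim]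
  simp

/-- let `Y₁, Z` be independent standard normal, `ρ ∈ (−1,1)`, and
`Y₂ = ρY₁ + √(1−ρ²)Z` (so `(Y₁,Y₂)` is centered bivariate Gaussian with unit variances and
correlation `ρ`).  Then `E[(Y₁² − 1)·1{Y₁ ≥ 0, Y₂ ≥ 0}] = ρ√(1−ρ²)/(2π)`. -/
theorem second_order_hermite_coefficient_diagonal
    {Ω : Type*} [MeasurableSpace Ω] (P : Measure Ω) [IsProbabilityMeasure P]
    (Y₁ Z : Ω → ℝ) (hY₁m : Measurable Y₁) (hZm : Measurable Z)
    (hindep : IndepFun Y₁ Z P)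
    (hY₁ : Measure.map Y₁ P = gaussianReal 0 1)
    (hZ : Measure.map Z P = gaussianReal 0 1)
    (ρ : ℝ) (hρ : ρ ∈ Set.Ioo (-1 : ℝ) 1)
    (Y₂ : Ω → ℝ) (hY₂ : Y₂ = fun ω => ρ * Y₁ ω + Real.sqrt (1 - ρ ^ 2) * Z ω) :
    ∫ ω, (Y₁ ω ^ 2 - 1) * (if 0 ≤ Y₁ ω ∧ 0 ≤ Y₂ ω then (1 : ℝ) else 0) ∂P
      = ρ * Real.sqrt (1 - ρ ^ 2) / (2 * Real.pi) := by
  have hρ' : 0 < 1 - ρ ^ 2 := by nlinarith [hρ.1, hρ.2]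
  set s := √(1 - ρ ^ 2) with hs
  have hs0 : 0 < s := sqrt_pos.2 hρ'
  have hs2 : s ^ 2 = 1 - ρ ^ 2 := sq_sqrt hρ'.le
  let g : ℝ × ℝ → ℝ := fun p ↦ if 0 ≤ p.1 ∧ 0 ≤ ρ * p.1 + s * p.2 then (1 : ℝ) else 0
  have hg : Measurable g := by
    refine Measurable.ite (MeasurableSet.inter ?_ ?_) measurable_const measurable_const
    · exact measurableSet_le measurable_const measurable_fst
    · exact measurableSet_le measurable_const
        ((measurable_fst.const_mul ρ).add (measurable_snd.const_mul s))
  have hlaw : P.map (fun ω ↦ (Y₁ ω, Z ω)) = (gaussianReal 0 1).prod (gaussianReal 0 1) := by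
    rw [(indepFun_iff_map_prod_eq_prod_map_map hY₁m.aemeasurable hZm.aemeasurable).1 hindep,
      hY₁, hZ]
  have hint : Integrable (fun p : ℝ × ℝ ↦ (p.1 ^ 2 - 1) * g p)
      ((gaussianReal 0 1).prod (gaussianReal 0 1)) :=
    (integrable_sq_sub_one_gaussianReal.comp_fst _).mul_bdd (c := 1) hg.aestronglyMeasurable
      (ae_of_all _ fun p ↦ by simp only [g]; split_ifs <;> simp)
  have hinner (y : ℝ) : ∫ z, (y ^ 2 - 1) * g (y, z) ∂gaussianReal 0 1 =
      (Set.Ici 0).indicator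
        (fun y ↦ (y ^ 2 - 1) * (gaussianReal 0 1).real (Set.Iic (ρ / s * y))) y := by
    rw [integral_const_mul]
    by_cases hy : 0 ≤ y
    · have h : (fun z ↦ g (y, z)) = (Set.Ici (-(ρ / s * y))).indicator 1 := by
        ext z
        have : 0 ≤ ρ * y + s * z ↔ -(ρ / s * y) ≤ z := by
          rw [← mul_le_mul_iff_right₀ hs0]
          field_simp
          constructor <;> intro <;> linarith
        simp [g, hy, this, Set.indicator_apply]
      rw [h, integral_indicator_one measurableSet_Ici, gaussianReal_real_Ici_neg,
        Set.indicator_of_mem (Set.mem_Ici.2 hy)]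
    · simp [g, hy]
  calc ∫ ω, (Y₁ ω ^ 2 - 1) * (if 0 ≤ Y₁ ω ∧ 0 ≤ Y₂ ω then (1 : ℝ) else 0) ∂P
      = ∫ p, (p.1 ^ 2 - 1) * g p ∂(P.map (fun ω ↦ (Y₁ ω, Z ω))) := by
        rw [integral_map (hY₁m.prodMk hZm).aemeasurable
          (by rw [hlaw]; exact hint.aestronglyMeasurable), hY₂]
    _ = ∫ y, (Set.Ici 0).indicator
        (fun y ↦ (y ^ 2 - 1) * (gaussianReal 0 1).real (Set.Iic (ρ / s * y))) y
          ∂gaussianReal 0 1 := by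
        rw [hlaw, integral_prod _ hint]
        exact integral_congr_ae (ae_of_all _ hinner)
    _ = ∫ y in Set.Ioi (0 : ℝ), (y ^ 2 - 1) * gaussianPDFReal 0 1 y *
        (gaussianReal 0 1).real (Set.Iic (ρ / s * y)) := by
        rw [integral_gaussianReal_eq_integral_smul one_ne_zero, ← integral_Ici_eq_integral_Ioi,
          ← integral_indicator measurableSet_Ici]
        refine integral_congr_ae (ae_of_all _ fun y ↦ ?_)
        simp only [Set.indicator_apply, smul_eq_mul]
        split_ifs <;> ring
    _ = ρ * s / (2 * π) := by
        rw [integral_Ioi_hermite_two_mul_gaussian]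
        have : 1 + (ρ / s) ^ 2 = 1 / s ^ 2 := by
          field_simp
          linarith
        rw [this]
        field_simp
end

section
/- Let Y_1 and Z be independent standard normal random variables, let ρ ∈ (−1,1), and set Y_2 := ρ Y_1 + √(1−ρ²) Z (so that (Y_1,Y_2) is a centered bivariate Gaussian vector with unit variances and correlation ρ). Then E[Y_1 Y_2·1{Y_1 ≥ 0, Y_2 ≥ 0}] − ρ·P(Y_1 ≥ 0, Y_2 ≥ 0) = √(1−ρ²)/(2π). -/
open MeasureTheory ProbabilityTheory

open Set Real in
/-- Polar-coordinate formula for the standard planar Gaussian measure, for functions that are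
homogeneous of degree `k`. -/
theorem integral_gaussianReal_prod_of_homogeneous (f : ℝ × ℝ → ℝ) (g : ℝ → ℝ) (k : ℕ)
    (hfg : ∀ r θ : ℝ, 0 < r → f (r * cos θ, r * sin θ) = r ^ k * g θ) :
    ∫ p, f p ∂((gaussianReal 0 1).prod (gaussianReal 0 1)) =
      (2 * π)⁻¹ * (∫ r in Ioi (0 : ℝ), r ^ (k + 1) * exp (-(1 / 2) * r ^ 2)) *
        ∫ θ in Ioo (-π) π, g θ := by
  have hdens : ∀ p : ℝ × ℝ, gaussianPDFReal 0 1 p.1 * gaussianPDFReal 0 1 p.2 =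
      (2 * π)⁻¹ * exp (-(1 / 2) * (p.1 ^ 2 + p.2 ^ 2)) := by
    intro p
    have hs : (√(2 * π))⁻¹ * (√(2 * π))⁻¹ = (2 * π)⁻¹ := by
      rw [← mul_inv, mul_self_sqrt (by positivity)]
    simp only [gaussianPDFReal, NNReal.coe_one, mul_one, sub_zero]
    rw [mul_mul_mul_comm, hs, ← exp_add]
    ring_nf
  rw [gaussianReal_of_var_ne_zero 0 one_ne_zero,
    prod_withDensity (measurable_gaussianPDF 0 1) (measurable_gaussianPDF 0 1),
    integral_withDensity_eq_integral_toReal_smul (by fun_prop)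
      (ae_of_all _ fun _ ↦ ENNReal.mul_lt_top gaussianPDF_lt_top gaussianPDF_lt_top)]
  simp only [ENNReal.toReal_mul, toReal_gaussianPDF, hdens, smul_eq_mul, mul_assoc]
  rw [integral_const_mul, ← Measure.volume_eq_prod, ← integral_comp_polarCoord_symm,
    ← setIntegral_prod_mul, ← Measure.volume_eq_prod]
  congr 1
  refine setIntegral_congr_fun polarCoord.open_target.measurableSet fun p hp ↦ ?_
  have hp1 : 0 < p.1 := hp.1
  have hsq : (p.1 * cos p.2) ^ 2 + (p.1 * sin p.2) ^ 2 = p.1 ^ 2 := by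
    linear_combination p.1 ^ 2 * cos_sq_add_sin_sq p.2
  simp only [polarCoord_symm_apply, smul_eq_mul, hfg p.1 p.2 hp1, hsq]
  ring

open Set Real in
theorem integral_pow_mul_exp_neg_half_mul_sq (k : ℕ) :
    ∫ r in Ioi (0 : ℝ), r ^ (2 * k + 1) * exp (-(1 / 2) * r ^ 2) = 2 ^ k * k.factorial := by
  have h := integral_rpow_mul_exp_neg_mul_rpow (p := 2) (q := ((2 * k + 1 : ℕ) : ℝ)) (b := 1 / 2)
    (by norm_num) (by linarith [Nat.cast_nonneg (α := ℝ) (2 * k + 1)]) (by norm_num)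
  have e1 : (((2 * k + 1 : ℕ) : ℝ) + 1) / 2 = k + 1 := by push_cast; ring
  have e2 : -(((2 * k + 1 : ℕ) : ℝ) + 1) / 2 = -((k + 1 : ℕ) : ℝ) := by push_cast; ring
  rw [e1, e2, Gamma_nat_eq_factorial, rpow_neg (by norm_num), rpow_natCast] at h
  simp only [rpow_natCast, rpow_two] at h
  rw [h, one_div, inv_pow, inv_inv, pow_succ]
  ring

open Set Real in
/-- In the range of polar angles, a half-plane intersected with a rotated one is an interval. -/
theorem cos_nonneg_and_sin_add_nonneg_iff {α θ : ℝ} (hα : α ∈ Ioo (-(π / 2)) (π / 2))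
    (hθ : θ ∈ Ioo (-π) π) : 0 ≤ cos θ ∧ 0 ≤ sin (θ + α) ↔ θ ∈ Icc (-α) (π / 2) := by
  obtain ⟨hα1, hα2⟩ := hα
  obtain ⟨hθ1, hθ2⟩ := hθ
  refine ⟨fun ⟨hc, hs⟩ ↦ ?_, fun ⟨h1, h2⟩ ↦ ⟨cos_nonneg_of_mem_Icc ⟨by linarith, h2⟩,
    sin_nonneg_of_nonneg_of_le_pi (by linarith) (by linarith)⟩⟩
  have h2 : θ ≤ π / 2 := by
    by_contra! h
    exact (cos_neg_of_pi_div_two_lt_of_lt h (by linarith)).not_ge hc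
  have h3 : -(π / 2) ≤ θ := by
    by_contra! h
    have := cos_neg_of_pi_div_two_lt_of_lt (x := -θ) (by linarith) (by linarith)
    rw [cos_neg] at this
    exact this.not_ge hc
  refine ⟨?_, h2⟩
  by_contra! h
  exact (sin_neg_of_neg_of_neg_pi_lt (by linarith) (by linarith)).not_ge hs

open Set Real in
theorem setIntegral_mul_indicator_cone {α : ℝ} (hα : α ∈ Ioo (-(π / 2)) (π / 2)) (g : ℝ → ℝ) :
    ∫ θ in Ioo (-π) π, g θ * (if 0 ≤ cos θ ∧ 0 ≤ sin (θ + α) then (1 : ℝ) else 0) =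
      ∫ θ in (-α)..(π / 2), g θ := by
  have hsub : Ioo (-π) π ∩ Icc (-α) (π / 2) = Icc (-α) (π / 2) :=
    inter_eq_right.2 fun θ hθ ↦
      ⟨by linarith [hα.2, hθ.1, pi_pos], by linarith [hθ.2, pi_pos]⟩
  rw [intervalIntegral.integral_of_le (by linarith [hα.1]), ← integral_Icc_eq_integral_Ioc, ← hsub,
    ← setIntegral_indicator measurableSet_Icc]
  refine setIntegral_congr_fun measurableSet_Ioo fun θ hθ ↦ ?_
  simp only [cos_nonneg_and_sin_add_nonneg_iff hα hθ, indicator_apply, mul_ite, mul_one, mul_zero]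

open Set Real in
theorem integral_two_mul_cos_mul_sin_add_sub (α : ℝ) :
    2 * (∫ θ in (-α)..(π / 2), cos θ * sin (θ + α)) - sin α * (∫ _θ in (-α)..(π / 2), (1 : ℝ)) =
      cos α := by
  rw [← intervalIntegral.integral_const_mul, ← intervalIntegral.integral_const_mul,
    ← intervalIntegral.integral_sub (Continuous.intervalIntegrable (by fun_prop) _ _)
      (Continuous.intervalIntegrable (by fun_prop) _ _),
    intervalIntegral.integral_eq_sub_of_hasDerivAt (f := fun θ ↦ -cos (2 * θ + α) / 2)]
  · have h1 : 2 * (π / 2) + α = α + π := by ring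
    have h2 : 2 * -α + α = -α := by ring
    simp only [h1, h2, cos_add_pi, cos_neg]
    ring
  · intro θ _
    have h := (((hasDerivAt_id θ).const_mul 2).add_const α).cos.neg.div_const 2
    refine h.congr_deriv ?_
    have h1 : 2 * θ + α = (θ + α) + θ := by ring
    have h2 : sin α = sin ((θ + α) - θ) := by ring_nf
    simp only [id, h1, h2, sin_add (θ + α), sin_sub (θ + α)]
    ring
  · exact Continuous.intervalIntegrable (by fun_prop) _ _

/-- let `Y₁, Z` be independent standard normal, `ρ ∈ (−1,1)`, and
`Y₂ = ρY₁ + √(1−ρ²)Z` (so `(Y₁,Y₂)` is centered bivariate Gaussian with unit variances and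
correlation `ρ`).  Then `E[Y₁Y₂·1{Y₁ ≥ 0, Y₂ ≥ 0}] − ρ·P(Y₁ ≥ 0, Y₂ ≥ 0) = √(1−ρ²)/(2π)`. -/
theorem second_order_hermite_coefficient_off_diagonal
    {Ω : Type*} [MeasurableSpace Ω] (P : Measure Ω) [IsProbabilityMeasure P]
    (Y₁ Z : Ω → ℝ) (hY₁m : Measurable Y₁) (hZm : Measurable Z)
    (hindep : IndepFun Y₁ Z P)
    (hY₁ : Measure.map Y₁ P = gaussianReal 0 1)
    (hZ : Measure.map Z P = gaussianReal 0 1)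
    (ρ : ℝ) (hρ : ρ ∈ Set.Ioo (-1 : ℝ) 1)
    (Y₂ : Ω → ℝ) (hY₂ : Y₂ = fun ω => ρ * Y₁ ω + Real.sqrt (1 - ρ ^ 2) * Z ω) :
    (∫ ω, Y₁ ω * Y₂ ω * (if 0 ≤ Y₁ ω ∧ 0 ≤ Y₂ ω then (1 : ℝ) else 0) ∂P)
        - ρ * (P {ω | 0 ≤ Y₁ ω ∧ 0 ≤ Y₂ ω}).toReal
      = Real.sqrt (1 - ρ ^ 2) / (2 * Real.pi) := by
  have hα : Real.arcsin ρ ∈ Set.Ioo (-(Real.pi / 2)) (Real.pi / 2) :=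
    ⟨Real.neg_pi_div_two_lt_arcsin.2 hρ.1, Real.arcsin_lt_pi_div_two.2 hρ.2⟩
  have hsin : Real.sin (Real.arcsin ρ) = ρ := Real.sin_arcsin hρ.1.le hρ.2.le
  have hcos : Real.cos (Real.arcsin ρ) = √(1 - ρ ^ 2) := Real.cos_arcsin ρ
  generalize Real.arcsin ρ = α at hα hsin hcos
  subst hY₂
  rw [← hcos, ← hsin]
  clear hcos hsin hρ
  have hmap : P.map (fun ω ↦ (Y₁ ω, Z ω)) = (gaussianReal 0 1).prod (gaussianReal 0 1) := by
    rw [hindep.map_prod_eq_prod_map_map hY₁m.aemeasurable hZm.aemeasurable, hY₁, hZ]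
  let c : ℝ × ℝ → ℝ :=
    fun p ↦ if 0 ≤ p.1 ∧ 0 ≤ Real.sin α * p.1 + Real.cos α * p.2 then 1 else 0
  have hS : MeasurableSet {p : ℝ × ℝ | 0 ≤ p.1 ∧ 0 ≤ Real.sin α * p.1 + Real.cos α * p.2} :=
    (measurableSet_le measurable_const measurable_fst).inter
      (measurableSet_le measurable_const (by fun_prop :
        Measurable fun p : ℝ × ℝ ↦ Real.sin α * p.1 + Real.cos α * p.2))
  have hc : Measurable c := Measurable.ite hS measurable_const measurable_const
  have hrot (r θ : ℝ) : Real.sin α * (r * Real.cos θ) + Real.cos α * (r * Real.sin θ) =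
      r * Real.sin (θ + α) := by
    rw [Real.sin_add]; ring
  have hcpolar (r θ : ℝ) (hr : 0 < r) : c (r * Real.cos θ, r * Real.sin θ) =
      if 0 ≤ Real.cos θ ∧ 0 ≤ Real.sin (θ + α) then 1 else 0 := by
    simp only [c, hrot, mul_nonneg_iff_of_pos_left hr]
  have hmoment : ∫ ω, Y₁ ω * (Real.sin α * Y₁ ω + Real.cos α * Z ω) *
      (if 0 ≤ Y₁ ω ∧ 0 ≤ Real.sin α * Y₁ ω + Real.cos α * Z ω then (1 : ℝ) else 0) ∂P =
      (2 * Real.pi)⁻¹ * 2 * ∫ θ in (-α)..(Real.pi / 2), Real.cos θ * Real.sin (θ + α) := by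
    rw [← setIntegral_mul_indicator_cone hα]
    have h := integral_gaussianReal_prod_of_homogeneous
      (fun p ↦ p.1 * (Real.sin α * p.1 + Real.cos α * p.2) * c p)
      (fun θ ↦ Real.cos θ * Real.sin (θ + α) *
        if 0 ≤ Real.cos θ ∧ 0 ≤ Real.sin (θ + α) then 1 else 0) 2
      (fun r θ hr ↦ by
        simp only [hcpolar r θ hr, hrot]
        ring)
    rw [← hmap, integral_map (by fun_prop) (Measurable.aestronglyMeasurable (by fun_prop)),
      integral_pow_mul_exp_neg_half_mul_sq 1] at h
    simpa [c] using h
  have hprob : (P {ω | 0 ≤ Y₁ ω ∧ 0 ≤ Real.sin α * Y₁ ω + Real.cos α * Z ω}).toReal =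
      (2 * Real.pi)⁻¹ * ∫ _θ in (-α)..(Real.pi / 2), (1 : ℝ) := by
    rw [← setIntegral_mul_indicator_cone hα]
    have h := integral_gaussianReal_prod_of_homogeneous c
      (fun θ ↦ 1 * if 0 ≤ Real.cos θ ∧ 0 ≤ Real.sin (θ + α) then 1 else 0) 0
      (fun r θ hr ↦ by
        rw [hcpolar r θ hr]
        ring)
    rw [integral_pow_mul_exp_neg_half_mul_sq 0] at h
    have h' : ∫ p, c p ∂(P.map fun ω ↦ (Y₁ ω, Z ω)) =
        (P {ω | 0 ≤ Y₁ ω ∧ 0 ≤ Real.sin α * Y₁ ω + Real.cos α * Z ω}).toReal := by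
      have hind : c = Set.indicator
          {p : ℝ × ℝ | 0 ≤ p.1 ∧ 0 ≤ Real.sin α * p.1 + Real.cos α * p.2} 1 := by
        ext p; simp [c, Set.indicator_apply]
      rw [hind, integral_indicator_one hS, Measure.real,
        Measure.map_apply (by fun_prop) hS]
      rfl
    rw [← h', hmap, h]
    simp
  rw [hmoment, hprob]
  linear_combination (2 * Real.pi)⁻¹ * integral_two_mul_cos_mul_sin_add_sub α
end

section
/- Let Y_1 and Z be independent standard normal random variables, let ρ ∈ (−1,1), and set Y_2 := ρ Y_1 + √(1−ρ²) Z. Define f := 1{Y_1 ≥ 0, Y_2 ≥ 0} + 1{Y_1 < 0, Y_2 < 0} (the indicator of coincident ordinal patterns of length h = 1), p := E f, the 2×2 matrix of second-order Hermite coefficients C := ( E[Y_i (f − p) Y_k] )_{i,k=1,2}, and the covariance matrix Σ := [[1, ρ],[ρ, 1]]. Then the matrix A := Σ^{−1} C Σ^{−1} satisfies A_{1,1} = A_{2,2} = −ρ/(π√(1−ρ²)) and A_{1,2} = A_{2,1} = 1/(π√(1−ρ²)). Equivalently, with φ the standard normal density, the weights in the limit distribution of the estimator of p for h = 1 are α̃^{(1,1)}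 = α̃^{(2,2)} = −2φ(0)²ρ/√(1−ρ²) and α̃^{(1,2)} = α̃^{(2,1)} = 2φ(0)²/√(1−ρ²). -/
open MeasureTheory ProbabilityTheory

namespace HalfSpaceGaussian

open Set

/-- The standard normal density. -/
local notation "φ" => gaussianPDFReal 0 1

/-- The standard normal distribution on the line. -/
local notation "γ" => gaussianReal 0 1

lemma hasDerivAt_stdGaussianPDF (x : ℝ) : HasDerivAt φ (-(x * φ x)) x := by
  have h : HasDerivAt (fun y : ℝ => -(y - 0) ^ 2 / (2 * ((1 : NNReal) : ℝ))) (-x) x := by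
    have := (((hasDerivAt_id x).sub_const 0).pow 2).neg.div_const (2 * ((1 : NNReal) : ℝ))
    refine this.congr_deriv ?_
    simp
    ring
  have := (h.exp.const_mul (√(2 * Real.pi * ((1 : NNReal) : ℝ)))⁻¹)
  refine this.congr_deriv ?_
  simp only [gaussianPDFReal]
  ring

lemma continuous_stdGaussianPDF : Continuous φ :=
  continuous_iff_continuousAt.2 fun x => (hasDerivAt_stdGaussianPDF x).continuousAt

lemma sq_stdGaussianPDF_zero : φ 0 ^ 2 = 1 / (2 * Real.pi) := by
  simp only [gaussianPDFReal, mul_pow, inv_pow]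
  rw [Real.sq_sqrt (by positivity)]
  simp

lemma stdGaussianPDF_le_one (x : ℝ) : φ x ≤ 1 := by
  have h1 : 1 ≤ √(2 * Real.pi * ((1 : NNReal) : ℝ)) := by
    rw [Real.one_le_sqrt]
    have := Real.two_le_pi
    simp only [NNReal.coe_one]
    linarith
  have h2 : Real.exp (-(x - 0) ^ 2 / (2 * ((1 : NNReal) : ℝ))) ≤ 1 := by
    rw [Real.exp_le_one_iff]
    simp only [NNReal.coe_one]
    have := sq_nonneg (x - 0)
    linarith
  exact mul_le_one₀ (inv_le_one_of_one_le₀ h1) (Real.exp_nonneg _) h2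

lemma setIntegral_stdGaussian (g : ℝ → ℝ) {S : Set ℝ} (hS : MeasurableSet S) :
    ∫ x in S, g x ∂γ = ∫ x in S, φ x * g x := by
  rw [gaussianReal_of_var_ne_zero 0 one_ne_zero]
  simpa only [toReal_gaussianPDF, smul_eq_mul] using
    setIntegral_withDensity_eq_setIntegral_toReal_smul (μ := volume)
      (measurable_gaussianPDF 0 1) (ae_of_all _ fun _ => gaussianPDF_lt_top) g hS

lemma integrable_stdGaussianPDF_mul {g : ℝ → ℝ} (hg : Integrable g γ) :
    Integrable (fun x => φ x * g x) := by
  rw [gaussianReal_of_var_ne_zero 0 one_ne_zero, integrable_withDensity_iff_integrable_smul'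
    (measurable_gaussianPDF 0 1) (ae_of_all _ fun _ => gaussianPDF_lt_top)] at hg
  simpa using hg

lemma integrable_pow_stdGaussian (n : ℕ) : Integrable (fun x => x ^ n) γ := by
  have := (memLp_id_gaussianReal' (μ := 0) (v := 1) n (by simp)).integrable_norm_pow'
  refine (integrable_norm_iff (by fun_prop)).1 ?_
  simpa using this

/-- Stein's integration by parts formula on a half-line. -/
lemma setIntegral_Ioi_stein {g g' : ℝ → ℝ} (a : ℝ) (hg : ∀ x, HasDerivAt g (g' x) x)
    (hgi : Integrable g γ) (hg'i : Integrable (fun x => g' x - x * g x) γ) :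
    ∫ x in Ioi a, (g' x - x * g x) ∂γ = -(φ a * g a) := by
  rw [setIntegral_stdGaussian _ measurableSet_Ioi]
  have hd : ∀ x, HasDerivAt (fun x => φ x * g x) (φ x * (g' x - x * g x)) x := fun x =>
    ((hasDerivAt_stdGaussianPDF x).mul (hg x)).congr_deriv (by ring)
  have h1 := (integrable_stdGaussianPDF_mul hg'i).integrableOn (s := Ioi a)
  have h2 := (integrable_stdGaussianPDF_mul hgi).integrableOn (s := Ioi a)
  rw [integral_Ioi_of_hasDerivAt_of_tendsto' (fun x _ => hd x) h1
    (tendsto_zero_of_hasDerivAt_of_integrableOn_Ioi (fun x _ => hd x) h1 h2), zero_sub]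

lemma setIntegral_Ioi_id (a : ℝ) : ∫ x in Ioi a, x ∂γ = φ a := by
  have := setIntegral_Ioi_stein (g := fun _ => -1) (g' := fun _ => 0) a
    (fun x => hasDerivAt_const x _) (integrable_const _)
    (by simpa using integrable_pow_stdGaussian 1)
  simpa using this

lemma setIntegral_Ioi_sq_sub_one (a : ℝ) : ∫ x in Ioi a, (x ^ 2 - 1) ∂γ = a * φ a := by
  have h := setIntegral_Ioi_stein (g := fun x => -x) (g' := fun _ => -1) a
    (fun x => (hasDerivAt_id x).neg) (Integrable.neg (by simpa using integrable_pow_stdGaussian 1))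
    (((integrable_pow_stdGaussian 2).sub (integrable_const 1)).congr
      (ae_of_all _ fun x => by simp; ring))
  calc _ = ∫ x in Ioi a, (-1 - x * -x) ∂γ := by congr 1; ext x; ring
    _ = _ := by rw [h]; ring

lemma hasDerivAt_stdGaussian_real_Ioi (c x : ℝ) :
    HasDerivAt (fun y => (γ : Measure ℝ).real (Ioi (-(c * y)))) (c * φ (c * x)) x := by
  have hi := integrable_gaussianPDFReal 0 1
  have h1 : ∀ a, (γ : Measure ℝ).real (Ioi a) = (∫ y in Ioi 0, φ y) - ∫ y in (0)..a, φ y :=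
      fun a => by
    have h := setIntegral_stdGaussian (fun _ => 1) (measurableSet_Ioi (a := a))
    rw [setIntegral_const] at h
    simp only [smul_eq_mul, mul_one] at h
    rw [h, ← intervalIntegral.integral_interval_add_Ioi (hi.integrableOn (s := Ioi 0))
      (hi.integrableOn (s := Ioi a))]
    ring
  have h2 : HasDerivAt (fun a => (γ : Measure ℝ).real (Ioi a)) (-φ (-(c * x))) (-(c * x)) := by
    simp only [h1]
    exact (intervalIntegral.integral_hasDerivAt_right (hi.intervalIntegrable)
      (continuous_stdGaussianPDF.stronglyMeasurableAtFilter _ _)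
      continuous_stdGaussianPDF.continuousAt).const_sub _
  have h3 : HasDerivAt (fun y => -(c * y)) (-c) x := by
    exact ((hasDerivAt_id x).const_mul c).neg.congr_deriv (by simp)
  refine (h2.comp x h3).congr_deriv ?_
  simp [gaussianPDFReal]
  ring

lemma integrable_mul_stdGaussianPDF_comp (c : ℝ) :
    Integrable (fun x => x * φ (c * x)) γ := by
  have h : Integrable (fun x : ℝ => x) γ := by simpa using integrable_pow_stdGaussian 1
  refine h.mul_bdd (c := 1)
    (continuous_stdGaussianPDF.comp (continuous_const_mul c)).aestronglyMeasurable
    (ae_of_all _ fun x => ?_)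
  rw [Real.norm_of_nonneg (gaussianPDFReal_nonneg _ _ _)]
  exact stdGaussianPDF_le_one _

lemma setIntegral_Ioi_zero_mul_stdGaussianPDF_comp (c : ℝ) :
    ∫ x in Ioi 0, x * φ (c * x) ∂γ = 1 / (2 * Real.pi * (1 + c ^ 2)) := by
  have hc : 1 + c ^ 2 ≠ 0 := by positivity
  have hd : ∀ x, HasDerivAt (fun x => -(1 + c ^ 2)⁻¹ * φ (c * x))
      ((1 + c ^ 2)⁻¹ * (c ^ 2 * (x * φ (c * x)))) x := fun x => by
    have h := ((hasDerivAt_stdGaussianPDF (c * x)).comp x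
      ((hasDerivAt_id x).const_mul c)).const_mul (-(1 + c ^ 2)⁻¹)
    refine h.congr_deriv ?_
    ring
  have he : ∀ x, (1 + c ^ 2)⁻¹ * (c ^ 2 * (x * φ (c * x))) - x * (-(1 + c ^ 2)⁻¹ * φ (c * x))
      = x * φ (c * x) := fun x => by
    field_simp
    ring
  have hb : Integrable (fun x => -(1 + c ^ 2)⁻¹ * φ (c * x)) γ := by
    refine Integrable.const_mul (Integrable.of_bound (C := 1)
      (continuous_stdGaussianPDF.comp (continuous_const_mul c)).aestronglyMeasurable
      (ae_of_all _ fun x => ?_)) _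
    rw [Function.comp_apply, Real.norm_of_nonneg (gaussianPDFReal_nonneg _ _ _)]
    exact stdGaussianPDF_le_one _
  have h := setIntegral_Ioi_stein 0 hd hb
    (by simpa only [he] using integrable_mul_stdGaussianPDF_comp c)
  simp only [he] at h
  rw [h, mul_zero]
  have := sq_stdGaussianPDF_zero
  calc _ = (1 + c ^ 2)⁻¹ * φ 0 ^ 2 := by ring
    _ = _ := by rw [this]; field_simp

lemma setIntegral_Ioi_zero_sq_sub_one_mul (c : ℝ) :
    ∫ x in Ioi 0, (x ^ 2 - 1) * (γ : Measure ℝ).real (Ioi (-(c * x))) ∂γ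
      = c / (2 * Real.pi * (1 + c ^ 2)) := by
  set T : ℝ → ℝ := fun x => (γ : Measure ℝ).real (Ioi (-(c * x)))
  have hT : ∀ x, HasDerivAt T (c * φ (c * x)) x := hasDerivAt_stdGaussian_real_Ioi c
  have hTc : Continuous T := continuous_iff_continuousAt.2 fun x => (hT x).continuousAt
  have hTb : ∀ x, ‖T x‖ ≤ 1 := fun x => by
    simp only [T]
    rw [Real.norm_of_nonneg measureReal_nonneg]
    exact measureReal_le_one
  have hi : Integrable (fun x => (x ^ 2 - 1) * T x) γ :=
    ((integrable_pow_stdGaussian 2).sub (integrable_const 1)).mul_bdd (c := 1)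
      hTc.aestronglyMeasurable (ae_of_all _ hTb)
  have hj := (integrable_mul_stdGaussianPDF_comp c).const_mul c
  have hd : ∀ x, HasDerivAt (fun x => -(x * T x)) (-(T x + x * (c * φ (c * x)))) x := fun x =>
    ((hasDerivAt_id x).mul (hT x)).neg.congr_deriv (by simp)
  have he : ∀ x, -(T x + x * (c * φ (c * x))) - x * -(x * T x)
      = (x ^ 2 - 1) * T x - c * (x * φ (c * x)) := fun x => by ring
  have hb : Integrable (fun x => -(x * T x)) γ := by
    have h : Integrable (fun x : ℝ => x) γ := by simpa using integrable_pow_stdGaussian 1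
    exact (h.mul_bdd (c := 1) hTc.aestronglyMeasurable (ae_of_all _ hTb)).neg
  have h := setIntegral_Ioi_stein 0 hd hb ((hi.sub hj).congr (ae_of_all _ fun x => (he x).symm))
  simp only [he] at h
  rw [integral_sub hi.integrableOn hj.integrableOn, integral_const_mul,
    setIntegral_Ioi_zero_mul_stdGaussianPDF_comp] at h
  simp only [zero_mul, neg_zero, mul_zero] at h
  rw [sub_eq_zero.1 h]
  ring

/-- The standard normal distribution on the plane. -/
local notation "γ₂" => Measure.prod (gaussianReal 0 1) (gaussianReal 0 1)

/-- The indicator that `x` and `ρ x + s z` have the same sign. -/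
noncomputable def signCoincidence (ρ s : ℝ) (w : ℝ × ℝ) : ℝ :=
  (if 0 ≤ w.1 ∧ 0 ≤ ρ * w.1 + s * w.2 then (1 : ℝ) else 0) +
    (if w.1 < 0 ∧ ρ * w.1 + s * w.2 < 0 then (1 : ℝ) else 0)

lemma measurable_signCoincidence (ρ s : ℝ) : Measurable (signCoincidence ρ s) := by
  refine Measurable.add (Measurable.ite ?_ measurable_const measurable_const)
    (Measurable.ite ?_ measurable_const measurable_const)
  · rw [ofPred_and]
    exact (measurableSet_le measurable_const measurable_fst).inter
      (measurableSet_le measurable_const (by fun_prop))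
  · rw [ofPred_and]
    exact (measurableSet_lt measurable_fst measurable_const).inter
      (measurableSet_lt (by fun_prop) measurable_const)

lemma norm_signCoincidence_le_one (ρ s : ℝ) (w : ℝ × ℝ) : ‖signCoincidence ρ s w‖ ≤ 1 := by
  unfold signCoincidence
  split_ifs with h1 h2 <;> norm_num
  linarith [h1.1, h2.1]

lemma map_neg_stdGaussian_prod :
    (γ₂).map (fun w : ℝ × ℝ => -w) = γ₂ := by
  have h := Measure.map_prod_map (f := fun x : ℝ => -x) (g := fun x : ℝ => -x)
    γ γ measurable_neg measurable_neg
  rw [gaussianReal_map_neg, neg_zero] at h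
  exact h.symm

instance nullSingletonClass_stdGaussian : NullSingletonClass (gaussianReal 0 1) :=
  nullSingletonClass_gaussianReal one_ne_zero

lemma integral_mul_signCoincidence {ρ s : ℝ} (hs : 0 < s) {q : ℝ × ℝ → ℝ}
    (hq : Integrable q (γ₂)) (heven : ∀ w, q (-w) = q w) :
    ∫ w, q w * signCoincidence ρ s w ∂γ₂
      = 2 * ∫ x in Ioi 0, ∫ z in Ioi (-(ρ / s * x)), q (x, z) ∂γ ∂γ := by
  set D : Set (ℝ × ℝ) := {w | 0 ≤ w.1 ∧ 0 ≤ ρ * w.1 + s * w.2} with hD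
  set E : Set (ℝ × ℝ) := {w | 0 < w.1 ∧ 0 < ρ * w.1 + s * w.2} with hE
  set N : Set (ℝ × ℝ) := {w | w.1 < 0 ∧ ρ * w.1 + s * w.2 < 0} with hN
  have hDm : MeasurableSet D := by
    rw [hD, ofPred_and]
    exact (measurableSet_le measurable_const measurable_fst).inter
      (measurableSet_le measurable_const (by fun_prop))
  have hEm : MeasurableSet E := by
    rw [hE, ofPred_and]
    exact (measurableSet_lt measurable_const measurable_fst).inter
      (measurableSet_lt measurable_const (by fun_prop))
  have hNm : MeasurableSet N := by
    rw [hN, ofPred_and]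
    exact (measurableSet_lt measurable_fst measurable_const).inter
      (measurableSet_lt (by fun_prop) measurable_const)
  have hsplit : ∀ w, q w * signCoincidence ρ s w = D.indicator q w + N.indicator q w := fun w => by
    simp only [signCoincidence, indicator, hD, hN, mem_ofPred_eq, mul_add, mul_ite, mul_one,
      mul_zero]
  have hNE : ∫ w, N.indicator q w ∂γ₂ = ∫ w, E.indicator q w ∂γ₂ := by
    conv_lhs => rw [← map_neg_stdGaussian_prod]
    rw [integral_map measurable_neg.aemeasurable]
    · congr 1
      ext w
      have : -w ∈ N ↔ w ∈ E := by
        simp only [hN, hE, mem_ofPred_eq, Prod.fst_neg, Prod.snd_neg]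
        constructor <;> rintro ⟨h1, h2⟩ <;> constructor <;> linarith
      by_cases hw : w ∈ E <;> simp [indicator, this, heven, hw]
    · rw [map_neg_stdGaussian_prod]
      exact (hq.indicator hNm).aestronglyMeasurable
  have hmem : ∀ x z : ℝ, -(ρ / s * x) < z ↔ 0 < ρ * x + s * z := fun x z => by
    rw [show ρ * x + s * z = s * (z - -(ρ / s * x)) by field_simp; ring,
      mul_pos_iff_of_pos_left hs, sub_pos]
  have hmem' : ∀ x z : ℝ, -(ρ / s * x) ≤ z ↔ 0 ≤ ρ * x + s * z := fun x z => by
    rw [show ρ * x + s * z = s * (z - -(ρ / s * x)) by field_simp; ring,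
      mul_nonneg_iff_of_pos_left hs, sub_nonneg]
  have hEi : ∫ w, E.indicator q w ∂γ₂
      = ∫ x in Ioi 0, ∫ z in Ioi (-(ρ / s * x)), q (x, z) ∂γ ∂γ := by
    rw [integral_prod _ (hq.indicator hEm), ← integral_indicator measurableSet_Ioi]
    congr 1
    ext x
    by_cases hx : 0 < x
    · rw [indicator_of_mem (mem_Ioi.2 hx), ← integral_indicator measurableSet_Ioi]
      simp [indicator, hE, hx, hmem]
    · simp [indicator, hE, hx]
  have hDi : ∫ w, D.indicator q w ∂γ₂
      = ∫ x in Ioi 0, ∫ z in Ioi (-(ρ / s * x)), q (x, z) ∂γ ∂γ := by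
    rw [integral_prod _ (hq.indicator hDm), ← setIntegral_congr_set Ioi_ae_eq_Ici.symm,
      ← integral_indicator measurableSet_Ici]
    congr 1
    ext x
    by_cases hx : 0 ≤ x
    · rw [indicator_of_mem (mem_Ici.2 hx), ← setIntegral_congr_set Ioi_ae_eq_Ici.symm,
        ← integral_indicator measurableSet_Ici]
      simp [indicator, hD, hx, hmem']
    · simp [indicator, hD, hx]
  simp only [hsplit]
  rw [integral_add (hq.indicator hDm) (hq.indicator hNm), hNE, hEi, hDi]
  ring

lemma integrable_fst_pow_mul_snd_pow (m n : ℕ) :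
    Integrable (fun w : ℝ × ℝ => w.1 ^ m * w.2 ^ n) (γ₂) :=
  (integrable_pow_stdGaussian m).mul_prod (integrable_pow_stdGaussian n)

lemma integral_mul_mul_signCoincidence {ρ s : ℝ} (hs : 0 < s) (h : ρ ^ 2 + s ^ 2 = 1) :
    ∫ w, w.1 * w.2 * signCoincidence ρ s w ∂γ₂ = s ^ 2 / Real.pi := by
  rw [integral_mul_signCoincidence hs (q := fun w => w.1 * w.2)
    (by simpa using integrable_fst_pow_mul_snd_pow 1 1) (fun w => by simp)]
  have he : ∀ x : ℝ, ∫ z in Ioi (-(ρ / s * x)), x * z ∂γ = x * φ (ρ / s * x) := fun x => by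
    rw [integral_const_mul, setIntegral_Ioi_id]
    simp [gaussianPDFReal]
  simp only [he]
  rw [setIntegral_Ioi_zero_mul_stdGaussianPDF_comp,
    show 1 + (ρ / s) ^ 2 = (s ^ 2)⁻¹ by field_simp; linarith]
  field_simp

lemma integral_snd_sq_sub_one_mul_signCoincidence {ρ s : ℝ} (hs : 0 < s)
    (h : ρ ^ 2 + s ^ 2 = 1) :
    ∫ w, (w.2 ^ 2 - 1) * signCoincidence ρ s w ∂γ₂ = -(ρ * s / Real.pi) := by
  rw [integral_mul_signCoincidence hs (q := fun w => w.2 ^ 2 - 1)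
    ((by simpa using integrable_fst_pow_mul_snd_pow 0 2 :
      Integrable (fun w : ℝ × ℝ => w.2 ^ 2) (γ₂)).sub (integrable_const 1))
    (fun w => by simp)]
  have he : ∀ x : ℝ, -(ρ / s * x) * φ (-(ρ / s * x)) = -(ρ / s) * (x * φ (ρ / s * x)) :=
    fun x => by simp [gaussianPDFReal]; ring
  simp only [setIntegral_Ioi_sq_sub_one, he]
  rw [integral_const_mul, setIntegral_Ioi_zero_mul_stdGaussianPDF_comp,
    show 1 + (ρ / s) ^ 2 = (s ^ 2)⁻¹ by field_simp; linarith]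
  field_simp

lemma integral_fst_sq_sub_one_mul_signCoincidence {ρ s : ℝ} (hs : 0 < s)
    (h : ρ ^ 2 + s ^ 2 = 1) :
    ∫ w, (w.1 ^ 2 - 1) * signCoincidence ρ s w ∂γ₂ = ρ * s / Real.pi := by
  rw [integral_mul_signCoincidence hs (q := fun w => w.1 ^ 2 - 1)
    ((by simpa using integrable_fst_pow_mul_snd_pow 2 0 :
      Integrable (fun w : ℝ × ℝ => w.1 ^ 2) (γ₂)).sub (integrable_const 1))
    (fun w => by simp)]
  have he : ∀ x : ℝ, ∫ _ in Ioi (-(ρ / s * x)), (x ^ 2 - 1) ∂γ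
      = (x ^ 2 - 1) * (γ : Measure ℝ).real (Ioi (-(ρ / s * x))) := fun x => by
    rw [setIntegral_const, smul_eq_mul, mul_comm]
  simp only [he]
  rw [setIntegral_Ioi_zero_sq_sub_one_mul,
    show 1 + (ρ / s) ^ 2 = (s ^ 2)⁻¹ by field_simp; linarith]
  field_simp

lemma integral_sq_stdGaussian : ∫ x, x ^ 2 ∂γ = 1 := by
  have h := variance_fun_id_gaussianReal (μ := 0) (v := 1)
  rw [variance_eq_sub (X := fun x => x) (memLp_id_gaussianReal 2)] at h
  simpa [integral_id_gaussianReal] using h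

/-- The quadratic form `a x² + b x z + d z²` integrated against the centered sign coincidence
indicator. -/
lemma integral_quadratic_mul_signCoincidence_sub {ρ s : ℝ} (hs : 0 < s)
    (h : ρ ^ 2 + s ^ 2 = 1) (a b d : ℝ) :
    ∫ w, (a * w.1 ^ 2 + b * (w.1 * w.2) + d * w.2 ^ 2) *
        (signCoincidence ρ s w - ∫ w, signCoincidence ρ s w ∂γ₂) ∂γ₂
      = (a * (ρ * s) + b * s ^ 2 - d * (ρ * s)) / Real.pi := by
  set p := ∫ w, signCoincidence ρ s w ∂γ₂ with hp
  have hx : Integrable (fun w : ℝ × ℝ => w.1 ^ 2) (γ₂) := by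
    simpa using integrable_fst_pow_mul_snd_pow 2 0
  have hz : Integrable (fun w : ℝ × ℝ => w.2 ^ 2) (γ₂) := by
    simpa using integrable_fst_pow_mul_snd_pow 0 2
  have hxz : Integrable (fun w : ℝ × ℝ => w.1 * w.2) (γ₂) := by
    simpa using integrable_fst_pow_mul_snd_pow 1 1
  have hmul : ∀ {q : ℝ × ℝ → ℝ}, Integrable q (γ₂) →
      Integrable (fun w => q w * signCoincidence ρ s w) (γ₂) := fun hq =>
    hq.mul_bdd (c := 1) (measurable_signCoincidence ρ s).aestronglyMeasurable
      (ae_of_all _ (norm_signCoincidence_le_one ρ s))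
  have hf : Integrable (signCoincidence ρ s) (γ₂) := by
    simpa using hmul (integrable_const 1)
  have ex : ∫ w : ℝ × ℝ, w.1 ^ 2 ∂γ₂ = 1 := by
    have h := integral_prod_mul (μ := γ) (ν := γ) (fun x : ℝ => x ^ 2) (fun _ : ℝ => (1 : ℝ))
    rw [integral_sq_stdGaussian] at h
    simpa using h
  have ez : ∫ w : ℝ × ℝ, w.2 ^ 2 ∂γ₂ = 1 := by
    have h := integral_prod_mul (μ := γ) (ν := γ) (fun _ : ℝ => (1 : ℝ)) (fun x : ℝ => x ^ 2)
    rw [integral_sq_stdGaussian] at h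
    simpa using h
  have exz : ∫ w : ℝ × ℝ, w.1 * w.2 ∂γ₂ = 0 := by
    simpa [integral_id_gaussianReal] using
      integral_prod_mul (μ := γ) (ν := γ) (fun x : ℝ => x) (fun x : ℝ => x)
  have hx1 : Integrable (fun w : ℝ × ℝ => w.1 ^ 2 - 1) (γ₂) := hx.sub (integrable_const 1)
  have hz1 : Integrable (fun w : ℝ × ℝ => w.2 ^ 2 - 1) (γ₂) := hz.sub (integrable_const 1)
  have he : ∀ w : ℝ × ℝ, (a * w.1 ^ 2 + b * (w.1 * w.2) + d * w.2 ^ 2) *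
      (signCoincidence ρ s w - p) =
      (a * ((w.1 ^ 2 - 1) * signCoincidence ρ s w) + b * (w.1 * w.2 * signCoincidence ρ s w)
        + d * ((w.2 ^ 2 - 1) * signCoincidence ρ s w) + (a + d) * signCoincidence ρ s w)
        - p * (a * w.1 ^ 2 + b * (w.1 * w.2) + d * w.2 ^ 2) := fun w => by ring
  simp only [he]
  have i1 := (hmul hx1).const_mul a
  have i2 := (hmul hxz).const_mul b
  have i3 := (hmul hz1).const_mul d
  have i4 := hf.const_mul (a + d)
  have j1 := hx.const_mul a
  have j2 := hxz.const_mul b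
  have j3 := hz.const_mul d
  refine (integral_sub (((i1.add i2).add i3).add i4)
    (((j1.add j2).add j3).const_mul p)).trans ?_
  rw [integral_add' ((i1.add i2).add i3) i4, integral_add' (i1.add i2) i3, integral_add' i1 i2,
    integral_const_mul p, integral_add' (j1.add j2) j3, integral_add' j1 j2]
  simp only [integral_const_mul]
  rw [ex, ez, exz, ← hp, integral_fst_sq_sub_one_mul_signCoincidence hs h,
    integral_mul_mul_signCoincidence hs h, integral_snd_sq_sub_one_mul_signCoincidence hs h]
  ring

end HalfSpaceGaussian

/-- let `Y₁, Z` be independent standard normal, `ρ ∈ (−1,1)`, and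
`Y₂ = ρY₁ + √(1−ρ²)Z`.  With `f = 1{Y₁ ≥ 0, Y₂ ≥ 0} + 1{Y₁ < 0, Y₂ < 0}` (indicator of
coincident ordinal patterns of length `h = 1`), `p = E f`, the matrix of second-order Hermite
coefficients `C = (E[Yᵢ(f − p)Yₖ])`, and `Σ = [[1,ρ],[ρ,1]]`, the matrix `A = Σ⁻¹ C Σ⁻¹`
satisfies `A₁₁ = A₂₂ = −ρ/(π√(1−ρ²))` and `A₁₂ = A₂₁ = 1/(π√(1−ρ²))`; equivalently, the
weights in the limit distribution of the estimator of `p` for `h = 1` are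
`α̃^{(1,1)} = α̃^{(2,2)} = −2φ(0)²ρ/√(1−ρ²)` and `α̃^{(1,2)} = α̃^{(2,1)} = 2φ(0)²/√(1−ρ²)`
(note `φ(0)² = 1/(2π)`). -/
theorem limit_weights_for_pattern_length_one
    {Ω : Type*} [MeasurableSpace Ω] (P : Measure Ω) [IsProbabilityMeasure P]
    (Y₁ Z : Ω → ℝ) (hY₁m : Measurable Y₁) (hZm : Measurable Z)
    (hindep : IndepFun Y₁ Z P)
    (hY₁ : Measure.map Y₁ P = gaussianReal 0 1)
    (hZ : Measure.map Z P = gaussianReal 0 1)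
    (ρ : ℝ) (hρ : ρ ∈ Set.Ioo (-1 : ℝ) 1)
    (Y₂ : Ω → ℝ) (hY₂ : Y₂ = fun ω => ρ * Y₁ ω + Real.sqrt (1 - ρ ^ 2) * Z ω) :
    let f : Ω → ℝ := fun ω =>
      (if 0 ≤ Y₁ ω ∧ 0 ≤ Y₂ ω then (1 : ℝ) else 0) +
      (if Y₁ ω < 0 ∧ Y₂ ω < 0 then (1 : ℝ) else 0)
    let p : ℝ := ∫ ω, f ω ∂P
    let Yv : Fin 2 → Ω → ℝ := ![Y₁, Y₂]
    let C : Matrix (Fin 2) (Fin 2) ℝ :=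
      Matrix.of fun i k => ∫ ω, Yv i ω * (f ω - p) * Yv k ω ∂P
    let Sigm : Matrix (Fin 2) (Fin 2) ℝ := !![1, ρ; ρ, 1]
    let A : Matrix (Fin 2) (Fin 2) ℝ := Sigm⁻¹ * C * Sigm⁻¹
    A 0 0 = -ρ / (Real.pi * Real.sqrt (1 - ρ ^ 2)) ∧
    A 1 1 = -ρ / (Real.pi * Real.sqrt (1 - ρ ^ 2)) ∧
    A 0 1 = 1 / (Real.pi * Real.sqrt (1 - ρ ^ 2)) ∧
    A 1 0 = 1 / (Real.pi * Real.sqrt (1 - ρ ^ 2)) := by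
  intro f p Yv C Sigm A
  obtain ⟨hρ1, hρ2⟩ := hρ
  have hpos : 0 < 1 - ρ ^ 2 := by nlinarith
  set s := Real.sqrt (1 - ρ ^ 2) with hs_def
  have hs : 0 < s := Real.sqrt_pos.2 hpos
  have hs2 : s ^ 2 = 1 - ρ ^ 2 := Real.sq_sqrt hpos.le
  have h1 : ρ ^ 2 + s ^ 2 = 1 := by rw [hs2]; ring
  have hmap : Measure.map (fun ω => (Y₁ ω, Z ω)) P
      = (gaussianReal 0 1).prod (gaussianReal 0 1) := by
    rw [(indepFun_iff_map_prod_eq_prod_map_map hY₁m.aemeasurable hZm.aemeasurable).1 hindep,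
      hY₁, hZ]
  have hint : ∀ g : ℝ × ℝ → ℝ, Measurable g →
      ∫ ω, g (Y₁ ω, Z ω) ∂P = ∫ w, g w ∂(gaussianReal 0 1).prod (gaussianReal 0 1) :=
    fun g hg => by
      rw [← hmap, integral_map (hY₁m.prodMk hZm).aemeasurable hg.aestronglyMeasurable]
  have hfm := HalfSpaceGaussian.measurable_signCoincidence ρ s
  have hf : ∀ ω, f ω = HalfSpaceGaussian.signCoincidence ρ s (Y₁ ω, Z ω) := fun ω => by
    simp only [f, hY₂, HalfSpaceGaussian.signCoincidence]
  have hp : p = ∫ w, HalfSpaceGaussian.signCoincidence ρ s w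
      ∂(gaussianReal 0 1).prod (gaussianReal 0 1) := by
    rw [← hint _ hfm]
    simp only [p, hf]
  have key : ∀ a b d : ℝ, ∫ ω, (a * Y₁ ω ^ 2 + b * (Y₁ ω * Z ω) + d * Z ω ^ 2) * (f ω - p) ∂P
      = (a * (ρ * s) + b * s ^ 2 - d * (ρ * s)) / Real.pi := fun a b d => by
    rw [← HalfSpaceGaussian.integral_quadratic_mul_signCoincidence_sub hs h1, ← hp,
      ← hint _ (by fun_prop)]
    simp only [hf]
  have c00 : C 0 0 = ρ * s / Real.pi := by
    calc C 0 0 = ∫ ω, (1 * Y₁ ω ^ 2 + 0 * (Y₁ ω * Z ω) + 0 * Z ω ^ 2) * (f ω - p) ∂P := by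
          simp only [C, Yv, Matrix.of_apply, Matrix.cons_val_zero]
          congr 1; ext ω; ring
      _ = _ := by rw [key]; ring
  have c01 : C 0 1 = s / Real.pi := by
    calc C 0 1 = ∫ ω, (ρ * Y₁ ω ^ 2 + s * (Y₁ ω * Z ω) + 0 * Z ω ^ 2) * (f ω - p) ∂P := by
          simp only [C, Yv, Matrix.of_apply, Matrix.cons_val_zero, Matrix.cons_val_one, hY₂]
          congr 1; ext ω; ring
      _ = (ρ ^ 2 + s ^ 2) * s / Real.pi := by rw [key]; ring
      _ = _ := by rw [h1, one_mul]
  have c10 : C 1 0 = s / Real.pi := by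
    rw [← c01]
    simp only [C, Matrix.of_apply]
    congr 1; ext ω; ring
  have c11 : C 1 1 = ρ * s / Real.pi := by
    calc C 1 1 = ∫ ω, (ρ ^ 2 * Y₁ ω ^ 2 + (2 * ρ * s) * (Y₁ ω * Z ω) + s ^ 2 * Z ω ^ 2)
            * (f ω - p) ∂P := by
          simp only [C, Yv, Matrix.of_apply, Matrix.cons_val_one, hY₂]
          congr 1; ext ω; simp only [Matrix.cons_val_fin_one]; ring
      _ = (ρ ^ 2 + s ^ 2) * (ρ * s) / Real.pi := by rw [key]; ring
      _ = _ := by rw [h1, one_mul]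
  have hC : C = !![ρ * s / Real.pi, s / Real.pi; s / Real.pi, ρ * s / Real.pi] := by
    rw [Matrix.eta_fin_two C, c00, c01, c10, c11]
  have hinv : Sigm⁻¹ = (s ^ 2)⁻¹ • !![1, -ρ; -ρ, 1] := by
    rw [Matrix.inv_def, Matrix.det_fin_two_of, Matrix.adjugate_fin_two_of, Ring.inverse_eq_inv',
      hs2]
    congr 2
    ring
  have hA : A = !![-ρ / (Real.pi * s), 1 / (Real.pi * s);
      1 / (Real.pi * s), -ρ / (Real.pi * s)] := by
    simp only [A, hinv, hC]
    have hr : ρ ^ 2 = 1 - s ^ 2 := by rw [← h1]; ring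
    ext i j
    fin_cases i <;> fin_cases j <;>
      · simp [Matrix.mul_apply, Fin.sum_univ_two]
        field_simp
        ring_nf
        simp only [show ρ ^ 3 = ρ * ρ ^ 2 by ring, hr]
        ring
  rw [hA]
  simp
end
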